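/- arXiv:2310.05440 — 4 statements merged into one kernel-verified Lean document; each statement's English description precedes it below -/
import Mathlib

section
/- Let G > 0, γ ≥ 0, σ_Y > 0 and ε⁰ ≥ 0 be real numbers and let M be a real 3×3 matrix with ‖M^dev‖ > σ_Y + γ·ε⁰. Set ε¹ = (‖M^dev‖ + 2G·ε⁰ − σ_Y)/(2G + γ) and let P(M) = [γ/(2G+γ) + (1 − (γ/(2G+γ))·κ)·σ_Y/‖M^dev‖]·M^dev + (1/3)·tr(M)·Id with κ = 1 − (2G/σ_Y)·ε⁰. Then ‖(P(M))^dev‖ = σ_Y + γ·ε¹; that is, the projected Mandel stress lies exactly on the updated yield surface. -/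
open Matrix

noncomputable section

/-- Real 3×3 matrices. -/
abbrev Mat3 : Type := Matrix (Fin 3) (Fin 3) ℝ

/-- Frobenius inner product ⟨A, B⟩ = tr(Aᵀ B). -/
def finner (A B : Mat3) : ℝ := (Aᵀ * B).trace

/-- Frobenius norm ‖A‖ = √⟨A, A⟩. -/
def fnorm (A : Mat3) : ℝ := Real.sqrt (finner A A)

/-- Deviatoric part A^dev = A − (1/3)·tr(A)·Id. -/
def dev (A : Mat3) : Mat3 := A - (A.trace / 3) • (1 : Mat3)

theorem fnorm_smul (c : ℝ) (A : Mat3) : fnorm (c • A) = |c| * fnorm A := by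
  have h : finner (c • A) (c • A) = c ^ 2 * finner A A := by
    simp only [finner, transpose_smul, Matrix.smul_mul, Matrix.mul_smul, trace_smul, smul_eq_mul]
    ring
  rw [fnorm, h, Real.sqrt_mul (sq_nonneg c), Real.sqrt_sq_eq_abs, fnorm]

theorem trace_dev (A : Mat3) : (dev A).trace = 0 := by
  simp [dev]

theorem dev_smul_dev_add_smul_one (c t : ℝ) (A : Mat3) :
    dev (c • dev A + t • (1 : Mat3)) = c • dev A := by
  have h : (c • dev A + t • (1 : Mat3)).trace / 3 = t := by
    simp [trace_dev]
  rw [dev, h, add_sub_cancel_right]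

/-- The plastic branch of the rate-independent return mapping puts the projected
Mandel stress exactly on the updated yield surface. -/
theorem projected_stress_on_updated_yield_surface
    (G γ σY ε₀ : ℝ) (hG : 0 < G) (hγ : 0 ≤ γ) (hσY : 0 < σY) (hε₀ : 0 ≤ ε₀)
    (M : Mat3) (hM : fnorm (dev M) > σY + γ * ε₀)
    (ε₁ : ℝ) (hε₁ : ε₁ = (fnorm (dev M) + 2 * G * ε₀ - σY) / (2 * G + γ))
    (κ : ℝ) (hκ : κ = 1 - (2 * G / σY) * ε₀)
    (P : Mat3)
    (hP : P = (γ / (2 * G + γ) + (1 - (γ / (2 * G + γ)) * κ) * σY / fnorm (dev M)) • dev M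
          + (M.trace / 3) • (1 : Mat3)) :
    fnorm (dev P) = σY + γ * ε₁ := by
  rw [hP, dev_smul_dev_add_smul_one, fnorm_smul]
  generalize fnorm (dev M) = N at *
  have hN : σY < N := by nlinarith [mul_nonneg hγ hε₀]
  have hN₀ : 0 < N := hσY.trans hN
  have hd : 0 < 2 * G + γ := by positivity
  have hε₁_nonneg : 0 ≤ ε₁ := by
    rw [hε₁]
    exact div_nonneg (by nlinarith [mul_nonneg hG.le hε₀]) hd.le
  have h : (γ / (2 * G + γ) + (1 - γ / (2 * G + γ) * κ) * σY / N) * N = σY + γ * ε₁ := by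
    rw [hκ, hε₁]
    field_simp
    ring
  rw [← abs_of_pos hN₀, ← abs_mul, abs_of_pos hN₀, h]
  exact abs_of_nonneg (by positivity)
end
end

section
/- Let G > 0, γ ≥ 0, σ_Y > 0 and ε⁰ ≥ 0 be real numbers and let M be a real 3×3 matrix. Define ε¹ = ε⁰ and P(M) = M if ‖M^dev‖ ≤ σ_Y + γ·ε⁰, and otherwise ε¹ = (‖M^dev‖ + 2G·ε⁰ − σ_Y)/(2G + γ) and P(M) = [γ/(2G+γ) + (1 − (γ/(2G+γ))·κ)·σ_Y/‖M^dev‖]·M^dev + (1/3)·tr(M)·Id with κ = 1 − (2G/σ_Y)·ε⁰. Then the discrete Karush–Kuhn–Tucker conditions hold: Δε := ε¹ − ε⁰ ≥ 0, F_Y := ‖(P(M))^dev‖ − (σ_Y + γ·ε¹) ≤ 0, and Δε·F_Y = 0. -/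
open Matrix

noncomputable section

theorem fnorm_smul_of_nonneg {c : ℝ} (hc : 0 ≤ c) (A : Mat3) :
    fnorm (c • A) = c * fnorm A := by
  have h : finner (c • A) (c • A) = c ^ 2 * finner A A := by
    simp only [finner, Matrix.transpose_smul, Matrix.smul_mul, Matrix.mul_smul,
      Matrix.trace_smul, smul_eq_mul]
    ring
  rw [fnorm, h, Real.sqrt_mul (sq_nonneg c), Real.sqrt_sq hc, fnorm]

/-- Discrete Karush–Kuhn–Tucker conditions for the rate-independent return mapping. -/
theorem return_mapping_KKT
    (G γ σY ε₀ : ℝ) (hG : 0 < G) (hγ : 0 ≤ γ) (hσY : 0 < σY) (hε₀ : 0 ≤ ε₀)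
    (M : Mat3)
    (κ : ℝ) (hκ : κ = 1 - (2 * G / σY) * ε₀)
    (ε₁ : ℝ)
    (hε₁ : ε₁ = if fnorm (dev M) ≤ σY + γ * ε₀ then ε₀
           else (fnorm (dev M) + 2 * G * ε₀ - σY) / (2 * G + γ))
    (P : Mat3)
    (hP : P = if fnorm (dev M) ≤ σY + γ * ε₀ then M
          else (γ / (2 * G + γ) + (1 - (γ / (2 * G + γ)) * κ) * σY / fnorm (dev M)) • dev M
               + (M.trace / 3) • (1 : Mat3)) :
    0 ≤ ε₁ - ε₀ ∧ fnorm (dev P) - (σY + γ * ε₁) ≤ 0 ∧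
      (ε₁ - ε₀) * (fnorm (dev P) - (σY + γ * ε₁)) = 0 := by
  split_ifs at hε₁ hP with h
  · subst hε₁ hP
    refine ⟨by simp, by linarith, by simp⟩
  · push Not at h
    have hN : 0 < fnorm (dev M) := by nlinarith [mul_nonneg hγ hε₀]
    have hD : 0 < 2 * G + γ := by linarith
    set N := fnorm (dev M) with hNdef
    have hc : γ / (2 * G + γ) + (1 - (γ / (2 * G + γ)) * κ) * σY / N =
        (γ * N + 2 * G * σY + 2 * G * γ * ε₀) / ((2 * G + γ) * N) := by
      rw [hκ]
      field_simp
      ring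
    have hF : fnorm (dev P) - (σY + γ * ε₁) = 0 := by
      rw [hP, dev_smul_dev_add_smul_one, hc, fnorm_smul_of_nonneg (by positivity), ← hNdef, hε₁]
      field_simp
      ring
    have hΔ : ε₁ - ε₀ = (N - (σY + γ * ε₀)) / (2 * G + γ) := by
      rw [hε₁]
      field_simp
      ring
    refine ⟨?_, hF.le, by rw [hF, mul_zero]⟩
    rw [hΔ]
    exact div_nonneg (by linarith) hD.le
end
end

section
/- Let ε̇₀ > 0, G > 0, σ* > 0, β > 0, τ > 0 and σ_Y > 0 be real numbers and let s > σ_Y. Define the viscoplastic residual g(x) = ε̇₀·((s − 2G·x − σ_Y)/σ*)^β − x/τ for x ∈ [0, (s − σ_Y)/(2G)]. Then g is strictly decreasing on this interval, g(0) > 0, g((s − σ_Y)/(2G)) < 0, and consequently there exists a unique x ∈ (0, (s − σ_Y)/(2G)) with g(x) = 0. -/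
noncomputable section

/-- The viscoplastic residual of the implicit Euler update is strictly decreasing,
positive at 0, negative at the right endpoint, and hence has a unique root in the
open interval. -/
theorem viscoplastic_residual_unique_root
    (εdot₀ G σstar β τ σY s : ℝ)
    (hε : 0 < εdot₀) (hG : 0 < G) (hσstar : 0 < σstar) (hβ : 0 < β)
    (hτ : 0 < τ) (hσY : 0 < σY) (hs : σY < s)
    (g : ℝ → ℝ)
    (hg : ∀ x, g x = εdot₀ * ((s - 2 * G * x - σY) / σstar) ^ β - x / τ) :
    StrictAntiOn g (Set.Icc 0 ((s - σY) / (2 * G))) ∧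
      0 < g 0 ∧
      g ((s - σY) / (2 * G)) < 0 ∧
      ∃! x, x ∈ Set.Ioo 0 ((s - σY) / (2 * G)) ∧ g x = 0 := by
  have hroot : 2 * G * ((s - σY) / (2 * G)) = s - σY := by field_simp
  have hend : 0 < (s - σY) / (2 * G) := div_pos (sub_pos.2 hs) (by positivity)
  have hanti : StrictAntiOn g (Set.Icc 0 ((s - σY) / (2 * G))) := by
    intro x _ y hy hxy
    have hy' : 2 * G * y ≤ s - σY := by
      rw [← hroot]
      exact mul_le_mul_of_nonneg_left hy.2 (by positivity)
    have hpow : ((s - 2 * G * y - σY) / σstar) ^ β < ((s - 2 * G * x - σY) / σstar) ^ β := by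
      apply Real.rpow_lt_rpow _ _ hβ
      · exact div_nonneg (by linarith) hσstar.le
      · have := mul_lt_mul_of_pos_left hxy (show 0 < 2 * G by positivity)
        exact div_lt_div_of_pos_right (by linarith) hσstar
    rw [hg, hg]
    exact sub_lt_sub (mul_lt_mul_of_pos_left hpow hε) (div_lt_div_of_pos_right hxy hτ)
  have hzero : 0 < g 0 := by
    have : 0 < (s - σY) / σstar := div_pos (sub_pos.2 hs) hσstar
    rw [hg, mul_zero, sub_zero, zero_div, sub_zero]
    positivity
  have hneg : g ((s - σY) / (2 * G)) < 0 := by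
    rw [hg, hroot, show s - (s - σY) - σY = 0 by ring, zero_div, Real.zero_rpow hβ.ne',
      mul_zero, zero_sub]
    exact neg_neg_of_pos (div_pos hend hτ)
  have hcont : Continuous g := by
    rw [funext hg]
    exact (continuous_const.mul ((by fun_prop : Continuous fun x =>
      (s - 2 * G * x - σY) / σstar).rpow_const fun _ => Or.inr hβ.le)).sub
      (continuous_id.div_const τ)
  refine ⟨hanti, hzero, hneg, ?_⟩
  obtain ⟨x, hx, hgx⟩ := intermediate_value_Ioo' hend.le hcont.continuousOn ⟨hneg, hzero⟩
  exact ⟨x, ⟨hx, hgx⟩, fun y hy => hanti.injOn (Set.Ioo_subset_Icc_self hy.1)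
    (Set.Ioo_subset_Icc_self hx) (hy.2.trans hgx.symm)⟩
end
end

section
/- Let G > 0 and K be real numbers, let E and N be real 3×3 matrices and Δε ∈ ℝ, and suppose the trial stress M^tri = 2G·E + (K − (2/3)G)·tr(E)·Id has s := ‖(M^tri)^dev‖ > 0 and N = (M^tri)^dev/s. Define the updated stress M = 2G·(E − Δε·N) + (K − (2/3)G)·tr(E − Δε·N)·Id. Then tr(M) = tr(M^tri), M^dev = ((s − 2G·Δε)/s)·(M^tri)^dev, and if 0 ≤ Δε ≤ s/(2G) then ‖M^dev‖ = s − 2G·Δε. -/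
open Matrix

noncomputable section

/-- Subtracting a multiple of the deviator of `A` from `A` rescales the deviator. -/
theorem dev_sub_smul_dev (c : ℝ) (A : Mat3) : dev (A - c • dev A) = (1 - c) • dev A := by
  have h : (A - c • dev A).trace = A.trace := by
    simp [trace_sub, trace_smul, trace_dev]
  rw [dev, h, sub_smul, one_smul, sub_right_comm]
  rfl

/-- The plastic correction of the return mapping: the updated Mandel stress keeps the
trace of the trial stress, scales its deviator, and satisfies
`‖M^dev‖ = ‖M^{tri,dev}‖ − 2GΔε`. -/
theorem return_mapping_stress_update
    (G K : ℝ) (hG : 0 < G)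
    (E N Mtri : Mat3) (Δε s : ℝ)
    (hMtri : Mtri = (2 * G) • E + ((K - (2 / 3) * G) * E.trace) • (1 : Mat3))
    (hs : s = fnorm (dev Mtri)) (hspos : 0 < s)
    (hN : N = s⁻¹ • dev Mtri)
    (M : Mat3)
    (hM : M = (2 * G) • (E - Δε • N)
          + ((K - (2 / 3) * G) * (E - Δε • N).trace) • (1 : Mat3)) :
    trace M = trace Mtri ∧
      dev M = ((s - 2 * G * Δε) / s) • dev Mtri ∧
      (0 ≤ Δε → Δε ≤ s / (2 * G) → fnorm (dev M) = s - 2 * G * Δε) := by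
  have htrN : N.trace = 0 := by rw [hN, trace_smul, trace_dev, smul_zero]
  have htr : (E - Δε • N).trace = E.trace := by
    rw [trace_sub, trace_smul, htrN, smul_zero, sub_zero]
  have hsub : M = Mtri - (2 * G * Δε / s) • dev Mtri := by
    have hflow : (2 * G) • Δε • N = (2 * G * Δε / s) • dev Mtri := by
      rw [hN, smul_smul, smul_smul, div_eq_mul_inv, mul_assoc]
    rw [hM, htr, smul_sub, hflow, sub_add_eq_add_sub, ← hMtri]
  have hdev : dev M = ((s - 2 * G * Δε) / s) • dev Mtri := by
    rw [hsub, dev_sub_smul_dev, sub_div, div_self hspos.ne']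
  refine ⟨?_, hdev, fun _ hle => ?_⟩
  · rw [hsub, trace_sub, trace_smul, trace_dev, smul_zero, sub_zero]
  · have hnonneg : 0 ≤ s - 2 * G * Δε := by
      rw [le_div_iff₀ (by positivity)] at hle
      linarith
    rw [hdev, fnorm_smul, ← hs, abs_of_nonneg (div_nonneg hnonneg hspos.le),
      div_mul_cancel₀ _ hspos.ne']
end
end
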